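/- Completeness of the grammar G_n: for every tuple (s_1, ..., s_n) of words over Σ_n with s_1···s_n ∈ O_n, the judgment ⊢_{G_n} I(s_1, ..., s_n) is derivable. Consequently, the language of G_n equals O_n. -/

import Mathlib

/-- The interleaved sequence `x_1, y_1, x_2, y_2, …, x_n, y_n` of the components
of two `n`-tuples of words (`0`-indexed: position `2t` is `x_{t+1}`, position
`2t+1` is `y_{t+1}`; positions `≥ 2n` are padded with `ε`). -/
def interleave (n : ℕ) (x y : Fin n → List (Fin n × Bool)) : ℕ → List (Fin n × Bool) :=
  fun ℓ => if h : ℓ < 2 * n then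
    (if ℓ % 2 = 0 then x ⟨ℓ / 2, by omega⟩ else y ⟨ℓ / 2, by omega⟩) else []

/-- Derivable judgments `⊢_{G_n} I(s_1, …, s_n)` of the grammar `G_n`:
* `empty` is the axiom `I(ε, …, ε)`;
* `binary` is the rule `I(w_1, …, w_n) ⇐ I(x_1, …, x_n), I(y_1, …, y_n)` for
  any factorization of `x_1 y_1 x_2 y_2 ⋯ x_n y_n` into `n` consecutive pieces
  `w_1, …, w_n` (given by cut indices `k`);
* `pair` adds a compatible pair `α, ᾱ` at endpoints of two distinct components
  (`u`/`v` select front or back);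
* `wrap` adds `α` and `ᾱ` at the two endpoints of a single component. -/
inductive Der (n : ℕ) : (Fin n → List (Fin n × Bool)) → Prop where
  | empty : Der n (fun _ => [])
  | binary (x y w : Fin n → List (Fin n × Bool)) (k : ℕ → ℕ)
      (hx : Der n x) (hy : Der n y)
      (h0 : k 0 = 0) (hend : k n = 2 * n) (hmono : ∀ j, j < n → k j ≤ k (j + 1))
      (hw : ∀ j : Fin n, w j =
        ((List.range' (k j) (k ((j : ℕ) + 1) - k j)).map (interleave n x y)).flatten) :
      Der n w
  | pair (x w : Fin n → List (Fin n × Bool)) (α : Fin n × Bool) (a b : Fin n)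
      (u v : Bool) (hab : a ≠ b) (hx : Der n x)
      (ha : w a = if u then α :: x a else x a ++ [α])
      (hb : w b = if v then (α.1, !α.2) :: x b else x b ++ [(α.1, !α.2)])
      (hother : ∀ j, j ≠ a → j ≠ b → w j = x j) :
      Der n w
  | wrap (x w : Fin n → List (Fin n × Bool)) (α : Fin n × Bool) (a : Fin n)
      (hx : Der n x)
      (ha : w a = α :: (x a ++ [(α.1, !α.2)]))
      (hother : ∀ j, j ≠ a → w j = x j) :
      Der n w

/-- Derivability of the judgment `⊢_{G_n} S(w)`, via the initial rule
`S(x_1 ⋯ x_n) ⇐ I(x_1, …, x_n)`. -/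
def SDer (n : ℕ) (w : List (Fin n × Bool)) : Prop :=
  ∃ s : Fin n → List (Fin n × Bool), Der n s ∧ w = (List.ofFn s).flatten


set_option linter.unusedSectionVars false

section Parity
open Classical Finset

/-- indicator in `ZMod 2` -/
noncomputable def ind2 (P : Prop) : ZMod 2 := if P then 1 else 0

variable {ι : Type} [Fintype ι]

/-- number of cuts strictly before `q` -/
noncomputable def cutsBefore (key : ι → ℕ) (k : ℕ) (p : Fin k → ι) (q : ι) : ℕ :=
  (univ.filter (fun j : Fin k => key (p j) < key q)).card

/-- signed sum of the letters of type `j` except `e` -/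
noncomputable def restSum (key : ι → ℕ) (c : ι → ℕ) (k : ℕ) (ν : ι → ℤ) (p : Fin k → ι)
    (j : ℕ) (e : ι) : ℤ :=
  ∑ q ∈ univ.filter (fun q => c q = j ∧ q ≠ e), (-1) ^ cutsBefore key k p q * ν q

noncomputable def fullSum (key : ι → ℕ) (c : ι → ℕ) (k : ℕ) (ν : ι → ℤ) (p : Fin k → ι)
    (j : ℕ) : ℤ :=
  ∑ q ∈ univ.filter (fun q => c q = j), (-1) ^ cutsBefore key k p q * ν q

def CutSol (key : ι → ℕ) (c : ι → ℕ) (k : ℕ) (ν : ι → ℤ) (p : Fin k → ι) : Prop :=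
  ∀ j : Fin k, c (p j) = j ∧ (restSum key c k ν p j (p j)) ^ 2 < ν (p j) ^ 2

def flipAt (key : ι → ℕ) (b : ℕ) (ν : ι → ℤ) : ι → ℤ :=
  fun q => if key q < b then ν q else - ν q

lemma zmod2_add_self (a : ZMod 2) : a + a = 0 := CharTwo.add_self_eq_zero a

lemma tele2 (g : ℕ → ZMod 2) (M : ℕ) : ∑ b ∈ range M, (g b + g (b+1)) = g 0 + g M := by
  induction M with
  | zero => simp [zmod2_add_self]
  | succ M ih =>
    rw [sum_range_succ, ih]
    have := zmod2_add_self (g M)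
    linear_combination this

lemma flipAt_sq (key : ι → ℕ) (b : ℕ) (ν : ι → ℤ) (q : ι) : (flipAt key b ν q)^2 = ν q ^ 2 := by
  unfold flipAt; split_ifs <;> ring

lemma odd_signed {s : Finset ι} (e : ι → ℕ) (ν : ι → ℤ) :
    Odd (∑ q ∈ s, (-1) ^ e q * ν q) ↔ Odd (∑ q ∈ s, ν q) := by
  induction s using Finset.induction_on with
  | empty => simp
  | insert a s ha ih =>
    rw [sum_insert ha, sum_insert ha, Int.odd_add, Int.odd_add, ← Int.not_odd_iff_even,
      ← Int.not_odd_iff_even, ih]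
    rcases neg_one_pow_eq_or ℤ (e a) with h | h <;> simp [h]

lemma odd_flip {s : Finset ι} (key : ι → ℕ) (b : ℕ) (e : ι → ℕ) (ν : ι → ℤ) :
    Odd (∑ q ∈ s, (-1) ^ e q * flipAt key b ν q) ↔ Odd (∑ q ∈ s, ν q) := by
  rw [← odd_signed (s := s) (fun q => e q + if key q < b then 0 else 1) ν]
  apply iff_of_eq; congr 1
  apply sum_congr rfl
  intro q _
  unfold flipAt; split_ifs <;> simp [pow_succ]

/-- four corners of a square -/
lemma square_parity (C α β : ℤ) (hodd : Odd (C + α + β)) :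
    ind2 ((C - α)^2 < β^2) + ind2 ((C + α)^2 < β^2)
      + (ind2 ((C - β)^2 < α^2) + ind2 ((C + β)^2 < α^2)) = 0 := by
  have key : ∀ x y : ℤ, Odd (x+y) → (x^2 < y^2 ↔ ¬ (0 < x - y ↔ 0 < x + y)) := by
    intro x y h
    have h1 : x + y ≠ 0 := by rintro h0; rw [h0] at h; simp at h
    have h2 : x - y ≠ 0 := by
      rintro h0; have : x + y = 2 * y := by linarith
      rw [this] at h; exact absurd h (by simp)
    have : x^2 < y^2 ↔ (x-y)*(x+y) < 0 := by constructor <;> intro h <;> nlinarith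
    rw [this, mul_neg_iff]
    omega
  obtain ⟨m, hm⟩ := hodd
  rw [key (C-α) β ⟨m - α, by linarith⟩, key (C+α) β ⟨m, by linarith⟩,
    key (C-β) α ⟨m - β, by linarith⟩, key (C+β) α ⟨m, by linarith⟩]
  rw [show C - β - α = C - α - β by ring, show C - β + α = C + α - β by ring,
    show C + β - α = C - α + β by ring, show C + β + α = C + α + β by ring]
  unfold ind2
  by_cases h1 : 0 < C - α - β <;> by_cases h2 : 0 < C - α + β <;> by_cases h3 : 0 < C + α - β <;>
    by_cases h4 : 0 < C + α + β <;> simp only [h1, h2, h3, h4] <;> simp <;> decide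

lemma two_corner (R a : ℤ) (hodd : Odd (R + a)) :
    ind2 (0 < R - a) + ind2 (0 < R + a) = ind2 (R^2 < a^2) := by
  have h1 : R + a ≠ 0 := by rintro h0; rw [h0] at hodd; simp at hodd
  have h2 : R - a ≠ 0 := by
    rintro h0; have : R + a = 2 * a := by linarith
    rw [this] at hodd; exact absurd hodd (by simp)
  have : R^2 < a^2 ↔ (R-a)*(R+a) < 0 := by constructor <;> intro h <;> nlinarith
  rw [this, mul_neg_iff]
  unfold ind2
  by_cases h3 : 0 < R - a <;> by_cases h4 : 0 < R + a
  · rw [if_pos h3, if_pos h4, if_neg (by omega)]; decide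
  · rw [if_pos h3, if_neg h4, if_pos (by omega)]; decide
  · rw [if_neg h3, if_pos h4, if_pos (by omega)]; decide
  · rw [if_neg h3, if_neg h4, if_neg (by omega)]; decide


lemma cuts_snoc (key : ι → ℕ) (k : ℕ) (p : Fin k → ι) (q r : ι) :
    cutsBefore key (k+1) (Fin.snoc p q : Fin (k+1) → ι) r
      = cutsBefore key k p r + if key q < key r then 1 else 0 := by
  unfold cutsBefore
  rw [card_filter, card_filter, Fin.sum_univ_castSucc]
  simp

lemma cuts_update (key : ι → ℕ) (k : ℕ) (p : Fin k → ι) (j : Fin k) (q r : ι) :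
    cutsBefore key k (Function.update p j q) r + (if key (p j) < key r then 1 else 0)
      = cutsBefore key k p r + if key q < key r then 1 else 0 := by
  unfold cutsBefore
  rw [card_filter, card_filter, ← add_sum_erase univ _ (mem_univ j),
    ← add_sum_erase univ (fun i => if key (p i) < key r then 1 else 0) (mem_univ j)]
  have : ∑ x ∈ univ.erase j, (if key (Function.update p j q x) < key r then 1 else 0)
     = ∑ x ∈ univ.erase j, (if key (p x) < key r then 1 else 0) := by
    apply sum_congr rfl
    intro x hx
    rw [Function.update_of_ne (ne_of_mem_erase hx)]
  rw [this]
  simp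
  ring

/-- sign of `r` with cuts `p` and an additional cut at `q` -/
noncomputable def sgn2 (key : ι → ℕ) (k : ℕ) (p : Fin k → ι) (q r : ι) : ℤ :=
  (-1) ^ (cutsBefore key k p r + if key q < key r then 1 else 0)

lemma sgn2_swap (key : ι → ℕ) (k : ℕ) (p : Fin k → ι) (j : Fin k) (q r : ι) :
    sgn2 key k (Function.update p j q) (p j) r = sgn2 key k p q r := by
  unfold sgn2
  rw [cuts_update]

lemma flip_off (key : ι → ℕ) (hkey : Function.Injective key) (k : ℕ) (p : Fin k → ι) (ν : ι → ℤ)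
    (q r : ι) (b : ℕ) (hb : b = key q ∨ b = key q + 1) (hr : r ≠ q) :
    (-1) ^ cutsBefore key k p r * flipAt key b ν r = sgn2 key k p q r * ν r := by
  have : key r ≠ key q := fun h => hr (hkey h)
  unfold sgn2 flipAt
  by_cases h : key q < key r
  · rw [if_neg (by omega), if_pos h, pow_succ]; ring
  · rw [if_pos (by omega), if_neg h]; simp

lemma restSum_off (key : ι → ℕ) (hkey : Function.Injective key) (c : ι → ℕ)
    (k : ℕ) (p : Fin k → ι) (ν : ι → ℤ)
    (q : ι) (b : ℕ) (hb : b = key q ∨ b = key q + 1) (j : ℕ) (hj : c q ≠ j) (e : ι) :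
    restSum key c k (flipAt key b ν) p j e =
      ∑ r ∈ univ.filter (fun r => c r = j ∧ r ≠ e), sgn2 key k p q r * ν r := by
  unfold restSum
  apply sum_congr rfl
  intro r hr
  rw [mem_filter] at hr
  apply flip_off key hkey k p ν q r b hb
  rintro rfl; exact hj hr.2.1

lemma fullSum_off (key : ι → ℕ) (hkey : Function.Injective key) (c : ι → ℕ)
    (k : ℕ) (p : Fin k → ι) (ν : ι → ℤ)
    (q : ι) (b : ℕ) (hb : b = key q ∨ b = key q + 1) (j : ℕ) (hj : c q ≠ j) :
    fullSum key c k (flipAt key b ν) p j =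
      ∑ r ∈ univ.filter (fun r => c r = j), sgn2 key k p q r * ν r := by
  unfold fullSum
  apply sum_congr rfl
  intro r hr
  rw [mem_filter] at hr
  apply flip_off key hkey k p ν q r b hb
  rintro rfl; exact hj hr.2

/-- the state predicate with integer cut at `b` -/
def CutState (key : ι → ℕ) (c : ι → ℕ) (k : ℕ) (ν : ι → ℤ) (b : ℕ) (p : Fin k → ι) : Prop :=
  CutSol key c k (flipAt key b ν) p ∧ 0 < fullSum key c k (flipAt key b ν) p k

noncomputable def cutTerm (key : ι → ℕ) (c : ι → ℕ) (k : ℕ) (ν : ι → ℤ) (q : ι) (p : Fin k → ι) :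
    ZMod 2 :=
  ind2 (CutState key c k ν (key q) p) + ind2 (CutState key c k ν (key q + 1) p)

/-- the part of a state that does not depend on type `j` -/
def CutCommon (key : ι → ℕ) (c : ι → ℕ) (k : ℕ) (ν : ι → ℤ) (j : Fin k) (q : ι) (p : Fin k → ι) :
    Prop :=
  (∀ i : Fin k, i ≠ j → c (p i) = i ∧
    (∑ r ∈ univ.filter (fun r => c r = i ∧ r ≠ p i), sgn2 key k p q r * ν r) ^ 2 < ν (p i) ^ 2) ∧
  0 < ∑ r ∈ univ.filter (fun r => c r = k), sgn2 key k p q r * ν r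

lemma state_iff (key : ι → ℕ) (hkey : Function.Injective key) (c : ι → ℕ)
    (k : ℕ) (p : Fin k → ι) (ν : ι → ℤ) (j : Fin k)
    (q : ι) (b : ℕ) (hb : b = key q ∨ b = key q + 1) (hj : c q = j) (hpj : c (p j) = j) :
    CutState key c k ν b p ↔ (CutCommon key c k ν j q p ∧
      (restSum key c k (flipAt key b ν) p j (p j)) ^ 2 < ν (p j) ^ 2) := by
  have hne : ∀ i : Fin k, i ≠ j → c q ≠ i := by
    intro i hi h; apply hi; apply Fin.ext; omega
  unfold CutState CutSol CutCommon
  rw [fullSum_off key hkey c k p ν q b hb k (by have := j.2; omega)]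
  constructor
  · rintro ⟨h1, h2⟩
    refine ⟨⟨fun i hi => ⟨(h1 i).1, ?_⟩, h2⟩, ?_⟩
    · have := (h1 i).2
      rwa [restSum_off key hkey c k p ν q b hb i (hne i hi), flipAt_sq] at this
    · have := (h1 j).2
      rwa [flipAt_sq] at this
  · rintro ⟨⟨h1, h2⟩, h3⟩
    refine ⟨fun i => ?_, h2⟩
    rw [flipAt_sq]
    by_cases hi : i = j
    · subst hi; exact ⟨hpj, h3⟩
    · rw [restSum_off key hkey c k p ν q b hb i (hne i hi)]
      exact h1 i hi

lemma common_swap (key : ι → ℕ) (c : ι → ℕ)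
    (k : ℕ) (p : Fin k → ι) (ν : ι → ℤ) (j : Fin k) (q : ι) :
    CutCommon key c k ν j (p j) (Function.update p j q) ↔ CutCommon key c k ν j q p := by
  unfold CutCommon
  simp only [sgn2_swap]
  apply and_congr_left'
  apply forall_congr'
  intro i
  apply imp_congr_right
  intro hi
  rw [Function.update_of_ne hi]

lemma rest_at (key : ι → ℕ) (hkey : Function.Injective key) (c : ι → ℕ)
    (k : ℕ) (p : Fin k → ι) (ν : ι → ℤ) (j : ℕ)
    (q e : ι) (b : ℕ) (hb : b = key q ∨ b = key q + 1) (hj : c q = j) (hq : q ≠ e) :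
    restSum key c k (flipAt key b ν) p j e =
      ∑ r ∈ univ.filter (fun r => c r = j ∧ r ≠ e ∧ r ≠ q), sgn2 key k p q r * ν r
      + (-1) ^ cutsBefore key k p q * flipAt key b ν q := by
  unfold restSum
  rw [← sum_erase_add _ _ (show q ∈ univ.filter (fun r => c r = j ∧ r ≠ e) by simp [hj, hq])]
  congr 1
  have : (univ.filter (fun r => c r = j ∧ r ≠ e)).erase q
      = univ.filter (fun r => c r = j ∧ r ≠ e ∧ r ≠ q) := by
    ext r; simp; tauto
  rw [this]
  apply sum_congr rfl
  intro r hr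
  rw [mem_filter] at hr
  exact flip_off key hkey k p ν q r b hb hr.2.2.2

lemma ind2_and (P Q : Prop) : ind2 (P ∧ Q) = ind2 P * ind2 Q := by
  unfold ind2; by_cases hP : P <;> by_cases hQ : Q <;> simp [hP, hQ]

lemma cutTerm_eq (key : ι → ℕ) (hkey : Function.Injective key) (c : ι → ℕ)
    (k : ℕ) (p : Fin k → ι) (ν : ι → ℤ) (j : Fin k)
    (q : ι) (hj : c q = j) (hpj : c (p j) = j) (hq : q ≠ p j) (C : ℤ)
    (hC : ∑ r ∈ univ.filter (fun r => c r = j ∧ r ≠ p j ∧ r ≠ q), sgn2 key k p q r * ν r = C) :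
    cutTerm key c k ν q p = ind2 (CutCommon key c k ν j q p) *
      (ind2 ((C - (-1) ^ cutsBefore key k p q * ν q) ^ 2 < ν (p j) ^ 2)
       + ind2 ((C + (-1) ^ cutsBefore key k p q * ν q) ^ 2 < ν (p j) ^ 2)) := by
  unfold cutTerm
  rw [state_iff key hkey c k p ν j q _ (Or.inl rfl) hj hpj,
    state_iff key hkey c k p ν j q _ (Or.inr rfl) hj hpj, ind2_and, ind2_and, ← mul_add,
    rest_at key hkey c k p ν j q (p j) _ (Or.inl rfl) hj hq,
    rest_at key hkey c k p ν j q (p j) _ (Or.inr rfl) hj hq, hC]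
  unfold flipAt
  simp [sub_eq_add_neg]

lemma cutTerm_same (key : ι → ℕ) (hkey : Function.Injective key) (c : ι → ℕ)
    (k : ℕ) (p : Fin k → ι) (ν : ι → ℤ) (j : Fin k)
    (q : ι) (hj : c q = j) (hq : q = p j) :
    cutTerm key c k ν q p = 0 := by
  have hpj : c (p j) = j := by rw [← hq]; exact hj
  have h : ∀ b, (b = key q ∨ b = key q + 1) → restSum key c k (flipAt key b ν) p j (p j)
      = ∑ r ∈ univ.filter (fun r => c r = j ∧ r ≠ p j), sgn2 key k p q r * ν r := by
    intro b hb
    unfold restSum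
    apply sum_congr rfl
    intro r hr
    rw [mem_filter] at hr
    apply flip_off key hkey k p ν q r b hb
    rw [hq]; exact hr.2.2
  unfold cutTerm
  rw [state_iff key hkey c k p ν j q _ (Or.inl rfl) hj hpj,
    state_iff key hkey c k p ν j q _ (Or.inr rfl) hj hpj, h _ (Or.inl rfl), h _ (Or.inr rfl)]
  exact zmod2_add_self _

lemma cutTerm_swap (key : ι → ℕ) (hkey : Function.Injective key) (c : ι → ℕ)
    (k : ℕ) (p : Fin k → ι) (ν : ι → ℤ) (j : Fin k)
    (hodd : Odd (∑ q ∈ univ.filter (fun q => c q = j), ν q))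
    (q : ι) (hj : c q = j) (hpj : c (p j) = j) (hq : q ≠ p j) :
    cutTerm key c k ν q p + cutTerm key c k ν (p j) (Function.update p j q) = 0 := by
  obtain ⟨C, hC⟩ : ∃ C, ∑ r ∈ univ.filter (fun r => c r = j ∧ r ≠ p j ∧ r ≠ q),
    sgn2 key k p q r * ν r = C := ⟨_, rfl⟩
  have hset : univ.filter (fun r => c r = j ∧ r ≠ q ∧ r ≠ p j)
      = univ.filter (fun r => c r = j ∧ r ≠ p j ∧ r ≠ q) := by
    ext r; simp; tauto
  have hset2 : univ.filter (fun r => c r = j) =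
    insert q (insert (p j) (univ.filter (fun r => c r = j ∧ r ≠ p j ∧ r ≠ q))) := by
    ext r; simp only [mem_filter, mem_univ, true_and, mem_insert]
    constructor
    · tauto
    · rintro (rfl | rfl | h)
      · exact hj
      · exact hpj
      · exact h.1
  rw [cutTerm_eq key hkey c k p ν j q hj hpj hq C hC,
    cutTerm_eq key hkey c k (Function.update p j q) ν j (p j) hpj (by simpa using hj)
      (by simpa using hq.symm) C (by
        simp only [sgn2_swap, Function.update_self]
        rw [hset, hC]),
    common_swap, Function.update_self, ← mul_add]
  obtain ⟨α, hα⟩ : ∃ α, (-1) ^ cutsBefore key k p q * ν q = α := ⟨_, rfl⟩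
  obtain ⟨β, hβ⟩ : ∃ β, (-1) ^ cutsBefore key k (Function.update p j q) (p j) * ν (p j) = β :=
    ⟨_, rfl⟩
  have hα2 : ν q ^ 2 = α ^ 2 := by
    rw [← hα, mul_pow, ← pow_mul, mul_comm _ 2, pow_mul]; simp
  have hβ2 : ν (p j) ^ 2 = β ^ 2 := by
    rw [← hβ, mul_pow, ← pow_mul, mul_comm _ 2, pow_mul]; simp
  rw [hα, hβ, hα2, hβ2, square_parity, mul_zero]
  have oα : Odd α ↔ Odd (ν q) := by
    rw [← hα]; rcases neg_one_pow_eq_or ℤ (cutsBefore key k p q) with h | h <;> simp [h]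
  have oβ : Odd β ↔ Odd (ν (p j)) := by
    rw [← hβ]
    rcases neg_one_pow_eq_or ℤ (cutsBefore key k (Function.update p j q) (p j)) with h | h <;>
      simp [h]
  have oC := odd_signed (s := univ.filter (fun r => c r = j ∧ r ≠ p j ∧ r ≠ q))
    (fun r => cutsBefore key k p r + if key q < key r then 1 else 0) ν
  unfold sgn2 at hC
  rw [hC] at oC
  rw [hset2, sum_insert (by simp [hq]), sum_insert (by simp)] at hodd
  simp only [Int.odd_add, ← Int.not_odd_iff_even] at hodd ⊢
  rw [oα, oβ, oC]
  tauto

lemma cutTerm_last (key : ι → ℕ) (hkey : Function.Injective key) (c : ι → ℕ)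
    (k : ℕ) (p : Fin k → ι) (ν : ι → ℤ)
    (hodd : Odd (∑ q ∈ univ.filter (fun q => c q = k), ν q))
    (q : ι) (hj : c q = k) :
    cutTerm key c k ν q p = ind2 (CutSol key c (k+1) ν (Fin.snoc p q : Fin (k+1) → ι)) := by
  have hS : ∀ (j : ℕ) (e : ι), restSum key c (k+1) ν (Fin.snoc p q : Fin (k+1) → ι) j e
      = ∑ r ∈ univ.filter (fun r => c r = j ∧ r ≠ e), sgn2 key k p q r * ν r := by
    intro j e
    unfold restSum sgn2
    simp only [cuts_snoc]
  have hsol : ∀ b, (b = key q ∨ b = key q + 1) → (CutSol key c k (flipAt key b ν) p ↔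
      ∀ i : Fin k, c (p i) = i ∧ (∑ r ∈ univ.filter (fun r => c r = i ∧ r ≠ p i),
        sgn2 key k p q r * ν r) ^ 2 < ν (p i) ^ 2) := by
    intro b hb
    unfold CutSol
    apply forall_congr'
    intro i
    rw [flipAt_sq, restSum_off key hkey c k p ν q b hb i (by have := i.2; omega)]
  have hfull : ∀ b, (b = key q ∨ b = key q + 1) → fullSum key c k (flipAt key b ν) p k
     = ∑ r ∈ univ.filter (fun r => c r = k ∧ r ≠ q), sgn2 key k p q r * ν r
        + (-1) ^ cutsBefore key k p q * flipAt key b ν q := by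
    intro b hb
    unfold fullSum
    rw [← sum_erase_add _ _ (show q ∈ univ.filter (fun r => c r = k) by simp [hj])]
    congr 1
    have : (univ.filter (fun r => c r = k)).erase q = univ.filter (fun r => c r = k ∧ r ≠ q) := by
      ext r; simp; tauto
    rw [this]
    apply sum_congr rfl
    intro r hr
    rw [mem_filter] at hr
    exact flip_off key hkey k p ν q r b hb hr.2.2
  unfold cutTerm CutState
  rw [ind2_and, ind2_and, hsol _ (Or.inl rfl), hsol _ (Or.inr rfl), hfull _ (Or.inl rfl),
    hfull _ (Or.inr rfl), ← mul_add]
  have e1 : flipAt key (key q) ν q = - ν q := by simp [flipAt]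
  have e2 : flipAt key (key q + 1) ν q = ν q := by simp [flipAt]
  rw [e1, e2, mul_neg, ← sub_eq_add_neg, two_corner, ← ind2_and]
  · congr 1
    apply propext
    unfold CutSol
    rw [Fin.forall_fin_succ']
    simp only [hS]
    simp [hj]
    intro _
    rw [mul_pow, ← pow_mul, mul_comm _ 2, pow_mul]; simp
  · rw [← sum_erase_add _ _ (show q ∈ univ.filter (fun r => c r = k) by simp [hj])] at hodd
    have : (univ.filter (fun r => c r = k)).erase q = univ.filter (fun r => c r = k ∧ r ≠ q) := by
      ext r; simp; tauto
    rw [this] at hodd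
    have oα : Odd ((-1) ^ cutsBefore key k p q * ν q) ↔ Odd (ν q) := by
      rcases neg_one_pow_eq_or ℤ (cutsBefore key k p q) with h | h <;> simp [h]
    have oC := odd_signed (s := univ.filter (fun r => c r = k ∧ r ≠ q))
      (fun r => cutsBefore key k p r + if key q < key r then 1 else 0) ν
    simp only [Int.odd_add, ← Int.not_odd_iff_even] at hodd ⊢
    unfold sgn2
    rw [oα, oC]
    exact hodd

lemma ind2_card {α : Type*} [Fintype α] (P : α → Prop) :
    (((univ.filter P).card : ℕ) : ZMod 2) = ∑ a, ind2 (P a) := by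
  unfold ind2
  rw [card_filter]; push_cast; rfl

lemma cutTerm_high (key : ι → ℕ) (hkey : Function.Injective key) (c : ι → ℕ)
    (k : ℕ) (p : Fin k → ι) (ν : ι → ℤ) (q : ι) (hj : k < c q) :
    cutTerm key c k ν q p = 0 := by
  have h : ∀ b, (b = key q ∨ b = key q + 1) → (CutState key c k ν b p ↔
      (∀ i : Fin k, c (p i) = i ∧ (∑ r ∈ univ.filter (fun r => c r = i ∧ r ≠ p i),
        sgn2 key k p q r * ν r) ^ 2 < ν (p i) ^ 2) ∧
      0 < ∑ r ∈ univ.filter (fun r => c r = k), sgn2 key k p q r * ν r) := by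
    intro b hb
    unfold CutState CutSol
    rw [fullSum_off key hkey c k p ν q b hb k (by omega)]
    apply and_congr_left'
    apply forall_congr'
    intro i
    rw [flipAt_sq, restSum_off key hkey c k p ν q b hb i (by have := i.2; omega)]
  unfold cutTerm
  rw [h _ (Or.inl rfl), h _ (Or.inr rfl)]
  exact zmod2_add_self _

lemma swap_sum (key : ι → ℕ) (hkey : Function.Injective key) (c : ι → ℕ)
    (k : ℕ) (ν : ι → ℤ) (j : Fin k)
    (hodd : Odd (∑ q ∈ univ.filter (fun q => c q = j), ν q)) :
    ∑ x : ι × (Fin k → ι), (if c x.1 = j ∧ c (x.2 j) = j then cutTerm key c k ν x.1 x.2 else 0)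
      = 0 := by
  apply Finset.sum_involution (fun (x : ι × (Fin k → ι)) _ => (x.2 j, Function.update x.2 j x.1))
  · rintro ⟨q, p⟩ _
    simp only [Function.update_self]
    by_cases h : c q = j ∧ c (p j) = j
    · rw [if_pos h, if_pos ⟨h.2, h.1⟩]
      by_cases hq : q = p j
      · have : Function.update p j q = p := by rw [hq]; simp
        rw [this, ← hq]
        exact zmod2_add_self _
      · exact cutTerm_swap key hkey c k p ν j hodd q h.1 h.2 hq
    · rw [if_neg h, if_neg (by tauto)]; simp
  · rintro ⟨q, p⟩ _ hne heq
    apply hne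
    have hq : p j = q := congrArg Prod.fst heq
    by_cases h : c q = j ∧ c (p j) = j
    · rw [if_pos h]
      exact cutTerm_same key hkey c k p ν j q h.1 hq.symm
    · rw [if_neg h]
  · intros; simp
  · rintro ⟨q, p⟩ _
    simp

theorem cut_parity (key : ι → ℕ) (hkey : Function.Injective key) (c : ι → ℕ) (k : ℕ) :
    ∀ ν : ι → ℤ, (∀ j < k, Odd (∑ q ∈ univ.filter (fun q => c q = j), ν q)) →
      ∑ p : Fin k → ι, ind2 (CutSol key c k ν p) = 1 := by
  induction k with
  | zero =>
    intro ν _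
    simp [CutSol, ind2]
  | succ k ih =>
    intro ν hodd
    have ihν := ih ν (fun j hj => hodd j (by omega))
    have hoddk := hodd k (by omega)
    obtain ⟨M, hM⟩ : ∃ M, ∀ q, key q < M := by
      refine ⟨univ.sup key + 1, fun q => ?_⟩
      have := Finset.le_sup (f := key) (mem_univ q)
      omega
    have htele := tele2 (fun b => ∑ p : Fin k → ι, ind2 (CutState key c k ν b p)) M
    -- ends
    have hends : ∑ p : Fin k → ι, ind2 (CutState key c k ν 0 p)
        + ∑ p : Fin k → ι, ind2 (CutState key c k ν M p) = 1 := by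
      rw [← ihν, ← sum_add_distrib]
      apply sum_congr rfl
      intro p _
      have f0 : flipAt key 0 ν = fun q => - ν q := by funext q; simp [flipAt]
      have fM : flipAt key M ν = ν := by funext q; simp [flipAt, hM]
      unfold CutState
      rw [f0, fM]
      have s0 : CutSol key c k (fun q => - ν q) p ↔ CutSol key c k ν p := by
        unfold CutSol restSum
        simp
      have t0 : fullSum key c k (fun q => - ν q) p k = - fullSum key c k ν p k := by
        unfold fullSum; simp
      have hne : fullSum key c k ν p k ≠ 0 := by
        intro h
        have := (odd_signed (s := univ.filter (fun q => c q = k)) (cutsBefore key k p) ν).2 hoddk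
        unfold fullSum at h
        rw [h] at this; simp at this
      rw [s0, t0]
      unfold ind2
      by_cases hs : CutSol key c k ν p
      · rcases lt_or_gt_of_ne hne with h | h
        · simp [hs, h, h.le]
        · simp [hs, h, h.le]
      · simp [hs]
    rw [hends] at htele
    have h1 : ∑ b ∈ range M, (∑ p : Fin k → ι, ind2 (CutState key c k ν b p)
        + ∑ p : Fin k → ι, ind2 (CutState key c k ν (b+1) p))
        = ∑ q : ι, ∑ p : Fin k → ι, cutTerm key c k ν q p := by
      have : ∑ q : ι, ∑ p : Fin k → ι, cutTerm key c k ν q p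
          = ∑ b ∈ univ.image key, (∑ p : Fin k → ι, ind2 (CutState key c k ν b p)
        + ∑ p : Fin k → ι, ind2 (CutState key c k ν (b+1) p)) := by
        rw [sum_image (fun x _ y _ h => hkey h)]
        apply sum_congr rfl
        intro q _
        unfold cutTerm
        rw [sum_add_distrib]
      rw [this]
      symm
      apply sum_subset
      · intro b hb
        simp only [mem_image, mem_univ, true_and] at hb
        obtain ⟨q, rfl⟩ := hb
        exact mem_range.2 (hM q)
      · intro b _ hb
        have : flipAt key b ν = flipAt key (b+1) ν := by
          funext q
          have : key q ≠ b := fun h => hb (by rw [← h]; simp)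
          unfold flipAt
          by_cases h : key q < b
          · rw [if_pos h, if_pos (by omega)]
          · rw [if_neg h, if_neg (by omega)]
        unfold CutState
        rw [this]
        exact zmod2_add_self _
    have h2 : ∀ (q : ι) (p : Fin k → ι), cutTerm key c k ν q p =
        (∑ j : Fin k, if c q = j ∧ c (p j) = j then cutTerm key c k ν q p else 0)
        + ind2 (CutSol key c (k+1) ν (Fin.snoc p q : Fin (k+1) → ι)) := by
      intro q p
      have hlast : CutSol key c (k+1) ν (Fin.snoc p q : Fin (k+1) → ι) → c q = k := by
        intro h
        have := (h (Fin.last k)).1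
        simpa using this
      rcases lt_trichotomy (c q) k with h | h | h
      · have : ind2 (CutSol key c (k+1) ν (Fin.snoc p q : Fin (k+1) → ι)) = 0 := by
          unfold ind2; rw [if_neg (fun h' => by have := hlast h'; omega)]
        rw [this, add_zero, Finset.sum_eq_single (⟨c q, h⟩ : Fin k)]
        · by_cases h' : c (p ⟨c q, h⟩) = c q
          · simp [h']
          · simp only [h', and_false, if_false]
            unfold cutTerm ind2 CutState
            rw [if_neg, if_neg, add_zero]
            · intro h''; exact h' (h''.1 ⟨c q, h⟩).1
            · intro h''; exact h' (h''.1 ⟨c q, h⟩).1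
        · intro j _ hj
          rw [if_neg]
          rintro ⟨h1, _⟩; apply hj; apply Fin.ext; simp [h1]
        · simp
      · rw [cutTerm_last key hkey c k p ν hoddk q h]
        rw [Finset.sum_eq_zero, zero_add]
        intro j _
        rw [if_neg]
        rintro ⟨h1, _⟩; have := j.2; omega
      · have : ind2 (CutSol key c (k+1) ν (Fin.snoc p q : Fin (k+1) → ι)) = 0 := by
          unfold ind2; rw [if_neg (fun h' => by have := hlast h'; omega)]
        rw [this, cutTerm_high key hkey c k p ν q h]
        simp
    have h3 : ∑ q : ι, ∑ p : Fin k → ι, cutTerm key c k ν q p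
        = ∑ p : Fin (k+1) → ι, ind2 (CutSol key c (k+1) ν p) := by
      rw [← Fintype.sum_prod_type']
      rw [Finset.sum_congr rfl (fun x _ => h2 x.1 x.2), sum_add_distrib, sum_comm]
      rw [Finset.sum_eq_zero (fun j _ => swap_sum key hkey c k ν j (hodd j (by omega))), zero_add]
      exact Equiv.sum_comp (Fin.snocEquiv (fun _ : Fin (k+1) => ι))
        (fun p => ind2 (CutSol key c (k+1) ν p))
    rw [← h3, ← h1, htele]

theorem cut_exists (key : ι → ℕ) (hkey : Function.Injective key) (c : ι → ℕ) (k : ℕ)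
    (ν : ι → ℤ) (hodd : ∀ j < k, Odd (∑ q ∈ univ.filter (fun q => c q = j), ν q)) :
    ∃ p : Fin k → ι, CutSol key c k ν p := by
  by_contra h
  push Not at h
  have := cut_parity key hkey c k ν hodd
  simp [ind2, h] at this

end Parity

section Split
open Classical Finset

lemma cuts_mono {ι : Type} [Fintype ι] (key : ι → ℕ) (k : ℕ) (p : Fin k → ι) (x y : ι)
    (h : key x ≤ key y) : cutsBefore key k p x ≤ cutsBefore key k p y := by
  unfold cutsBefore
  apply card_le_card
  intro j
  simp only [mem_filter, mem_univ, true_and]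
  omega

lemma cuts_add_one {ι : Type} [Fintype ι] (key : ι → ℕ) (k : ℕ) (p : Fin k → ι) (j : Fin k) (y : ι)
    (h : key (p j) < key y) : cutsBefore key k p (p j) + 1 ≤ cutsBefore key k p y := by
  unfold cutsBefore
  apply Finset.card_lt_card
  rw [Finset.ssubset_iff_of_subset]
  · exact ⟨j, by simp [h], by simp⟩
  · intro i
    simp only [mem_filter, mem_univ, true_and]
    omega

lemma cuts_le {ι : Type} [Fintype ι] (key : ι → ℕ) (k : ℕ) (p : Fin k → ι) (y : ι) :
    cutsBefore key k p y ≤ k := by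
  unfold cutsBefore
  exact (card_le_univ _).trans (by simp)

lemma cuts_lt {ι : Type} [Fintype ι] (key : ι → ℕ) (k : ℕ) (p : Fin k → ι) (j : Fin k) :
    cutsBefore key k p (p j) + 1 ≤ k := by
  unfold cutsBefore
  have : (univ.filter (fun i : Fin k => key (p i) < key (p j))).card < (univ : Finset (Fin k)).card := by
    apply Finset.card_lt_card
    rw [Finset.ssubset_iff_of_subset (by simp)]
    exact ⟨j, by simp, by simp⟩
  simpa using this

/-- value of a letter -/
def lval {n : ℕ} (α : Fin n × Bool) : ℤ := if α.2 then 1 else -1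

lemma lval_cases {n : ℕ} (α : Fin n × Bool) : lval α = 1 ∨ lval α = -1 := by
  unfold lval; split_ifs <;> simp

/-- strictly monotone self-maps of an initial segment -/
lemma strict_id (n : ℕ) (f : Fin n → Fin n) (hf : StrictMono f) (i : Fin n) : f i = i :=
  le_antisymm hf.apply_le hf.le_apply

theorem split_exists (n N : ℕ) (lt : Fin N → Fin n × Bool) (w : Fin N → ℕ) (hw : Monotone w)
    (hwn : ∀ q, w q < n) (hsurj : ∀ i < n, ∃ q, w q = i)
    (hbal : ∀ i : Fin n, ∑ q ∈ univ.filter (fun q => (lt q).1 = i), lval (lt q) = 0)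
    (a a' : Fin N) (ha : a'.val = a.val + 1) (haw : w a = w a')
    (d : Fin n → ℤ) (hd : ∀ i, d i = 1 ∨ d i = -1)
    (hend : ∀ q, (∀ q1 q2, q1 < q → q < q2 → w q1 = w q → w q2 = w q → False) →
      lval (lt q) = d (lt q).1) :
    ∃ β : Fin N → ℕ, Monotone β ∧ (∀ q, β q < 2 * n) ∧ (∀ q q', w q < w q' → β q < β q') ∧
      (∀ i : Fin n, ∑ q ∈ univ.filter (fun q => (lt q).1 = i), (-1) ^ β q * lval (lt q) = 0) ∧
      (∀ τ, ¬ ∀ q, β q % 2 = τ) := by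
  let key : Fin N ⊕ Fin n → ℕ := Sum.elim (fun q => q * (n+1)) (fun i => a * (n+1) + 1 + i)
  have K1 : ∀ q q' : Fin N, key (Sum.inl q) < key (Sum.inl q') ↔ q < q' := by
    intro q q'
    simp only [key, Sum.elim_inl, Fin.lt_def]
    exact Nat.mul_lt_mul_right (by omega)
  have K2 : ∀ i : Fin n, key (Sum.inl a) < key (Sum.inr i) := by
    intro i; simp only [key, Sum.elim_inl, Sum.elim_inr]; omega
  have K3 : ∀ i : Fin n, key (Sum.inr i) < key (Sum.inl a') := by
    intro i; simp only [key, Sum.elim_inl, Sum.elim_inr, ha]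
    have := i.2
    rw [Nat.add_mul]; omega
  have hmono' : ∀ q q' : Fin N, q ≤ q' → key (Sum.inl q) ≤ key (Sum.inl q') := by
    intro q q' h
    by_contra h'
    have := (K1 q' q).1 (by omega)
    exact absurd h (not_le.2 this)
  have hkey : Function.Injective key := by
    have hx : ∀ (q : Fin N) (i : Fin n), key (Sum.inl q) ≠ key (Sum.inr i) := by
      intro q i
      rcases le_or_gt q a with h | h
      · have := hmono' _ _ h
        have := K2 i; omega
      · have : a' ≤ q := by rw [Fin.le_def, ha]; exact h
        have := hmono' _ _ this
        have := K3 i; omega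
    rintro (q | i) (q' | i') h
    · congr 1
      have h1 := K1 q q'
      have h2 := K1 q' q
      rw [h] at h1 h2
      simp only [lt_self_iff_false, false_iff] at h1 h2
      exact le_antisymm (not_lt.1 h2) (not_lt.1 h1)
    · exact absurd h (hx _ _)
    · exact absurd h.symm (hx _ _)
    · congr 1
      simp only [key, Sum.elim_inr] at h
      apply Fin.ext; omega
  let c : Fin N ⊕ Fin n → ℕ := Sum.elim (fun q => ((lt q).1 : ℕ)) (fun i => (i : ℕ))
  let ww : Fin N ⊕ Fin n → ℕ := Sum.elim w (fun _ => w a)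
  let m : Fin N ⊕ Fin n → ℤ := Sum.elim (fun q => 2 * lval (lt q)) (fun i => - d i)
  let ν : Fin N ⊕ Fin n → ℤ := fun x => (-1) ^ ww x * m x
  have hνsq : ∀ x, ν x ^ 2 = m x ^ 2 := by
    intro x
    simp only [ν]
    rw [mul_pow, ← pow_mul, mul_comm _ 2, pow_mul]; simp
  have hsum : ∀ (i : Fin n) (f : Fin N ⊕ Fin n → ℤ) (P : Fin N ⊕ Fin n → Prop),
      ∑ x ∈ univ.filter (fun x => c x = i ∧ P x), f x
      = ∑ q ∈ univ.filter (fun q => (lt q).1 = i ∧ P (Sum.inl q)), f (Sum.inl q)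
        + if P (Sum.inr i) then f (Sum.inr i) else 0 := by
    intro i f P
    rw [sum_filter, Fintype.sum_sum_type, ← sum_filter]
    congr 1
    · apply sum_congr _ (fun _ _ => rfl)
      ext q
      rw [mem_filter, mem_filter]
      simp [c, Fin.ext_iff]
    · rw [Finset.sum_eq_single i]
      · simp [c]
      · intro b _ hb
        rw [if_neg]
        rintro ⟨h, _⟩
        exact hb (Fin.ext h)
      · simp
  have hoddν : ∀ j < n, Odd (∑ x ∈ univ.filter (fun x => c x = j), ν x) := by
    intro j hj
    have h := hsum ⟨j, hj⟩ m (fun _ => True)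
    simp only [and_true, if_true] at h
    simp only [ν]
    rw [odd_signed, h]
    simp only [m, Sum.elim_inl, Sum.elim_inr]
    rw [← mul_sum, hbal]
    rcases hd ⟨j, hj⟩ with h | h <;> rw [h] <;> decide
  obtain ⟨p, hp⟩ := cut_exists key hkey c n ν hoddν
  let cnt := cutsBefore key n p
  have hpc : ∀ i, c (p i) = i := fun i => (hp i).1
  -- the rest sums
  have hR : ∀ i : Fin n, (∑ q ∈ univ.filter (fun q => (lt q).1 = i ∧ Sum.inl q ≠ p i),
      (-1) ^ (cnt (Sum.inl q) + w q) * (2 * lval (lt q))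
      + if Sum.inr i ≠ p i then (-1) ^ (cnt (Sum.inr i) + w a) * (- d i) else 0) ^ 2
      < m (p i) ^ 2 := by
    intro i
    have h := (hp i).2
    unfold restSum at h
    rw [hνsq] at h
    have hs := hsum i (fun x => (-1) ^ cutsBefore key n p x * ν x) (fun x => x ≠ p i)
    convert h using 2
    refine Eq.trans ?_ (Eq.trans hs.symm ?_)
    swap
    · congr
    congr 1
    · apply sum_congr (by congr)
      intro q _
      simp only [ν, ww, m, cnt, Sum.elim_inl, pow_add, mul_assoc]
    · simp only [ν, ww, m, cnt, Sum.elim_inr, pow_add, mul_assoc]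
      congr
  -- rounding
  have hround : ∀ i : Fin n, ∃ δ : ℕ, δ ≤ 1 ∧
      ∑ q ∈ univ.filter (fun q => (lt q).1 = i),
        (-1) ^ (cnt (Sum.inl q) + w q + if Sum.inl q = p i then δ else 0) * lval (lt q) = 0 := by
    intro i
    have h := hR i
    rcases hpi : p i with q0 | i0
    · rw [hpi] at h
      have hq0 : (lt q0).1 = i := by
        have := hpc i; rw [hpi] at this; exact Fin.ext this
      simp only [ne_eq, Sum.inl.injEq, reduceCtorEq, not_false_eq_true, if_true, m, Sum.elim_inl]
        at h
      have hset : univ.filter (fun q => (lt q).1 = i)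
          = insert q0 (univ.filter (fun q => (lt q).1 = i ∧ ¬ q = q0)) := by
        ext q; simp only [mem_filter, mem_univ, true_and, mem_insert]
        constructor
        · tauto
        · rintro (rfl | h)
          · exact hq0
          · exact h.1
      obtain ⟨E, hE⟩ : ∃ E, ∑ q ∈ univ.filter (fun q => (lt q).1 = i ∧ ¬ q = q0),
        (-1) ^ (cnt (Sum.inl q) + w q) * lval (lt q) = E := ⟨_, rfl⟩
      have hE2 : ∑ q ∈ univ.filter (fun q => (lt q).1 = i ∧ ¬ q = q0),
        (-1) ^ (cnt (Sum.inl q) + w q) * (2 * lval (lt q)) = 2 * E := by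
        rw [← hE, mul_sum]; apply sum_congr rfl; intros; ring
      rw [hE2] at h
      have hb := hbal i
      rw [hset, sum_insert (by simp)] at hb
      have hEodd : Odd E := by
        rw [← hE, odd_signed (fun q => cnt (Sum.inl q) + w q)]
        have : ∑ q ∈ univ.filter (fun q => (lt q).1 = i ∧ ¬ q = q0), lval (lt q)
          = - lval (lt q0) := by linarith
        rw [this]
        rcases lval_cases (lt q0) with h | h <;> rw [h] <;> decide
      have hE1 : E = 1 ∨ E = -1 := by
        obtain ⟨t, ht⟩ := hEodd
        have hD : (-1) ^ (cnt (Sum.inr i) + w a) * (- d i) = 1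
            ∨ (-1) ^ (cnt (Sum.inr i) + w a) * (- d i) = -1 := by
          rcases neg_one_pow_eq_or ℤ (cnt (Sum.inr i) + w a) with h1 | h1 <;>
          rcases hd i with h2 | h2 <;> rw [h1, h2] <;> simp
        have hl : (2 * lval (lt q0)) ^ 2 = 4 := by
          rcases lval_cases (lt q0) with h | h <;> rw [h] <;> norm_num
        rw [hl] at h
        rcases hD with hD | hD <;> rw [hD] at h
        · have h1 : 2 * E + 1 < 2 := by nlinarith
          have h2 : -2 < 2 * E + 1 := by nlinarith
          omega
        · have h1 : 2 * E + -1 < 2 := by nlinarith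
          have h2 : -2 < 2 * E + -1 := by nlinarith
          omega
      have hfin : ∀ δ : ℕ, ∑ q ∈ univ.filter (fun q => (lt q).1 = i),
        (-1) ^ (cnt (Sum.inl q) + w q +
          if (Sum.inl q : Fin N ⊕ Fin n) = Sum.inl q0 then δ else 0) * lval (lt q)
          = (-1) ^ (cnt (Sum.inl q0) + w q0) * lval (lt q0) * (-1) ^ δ + E := by
        intro δ
        rw [hset, sum_insert (by simp), ← hE]
        congr 1
        · simp [pow_add]; ring
        · apply sum_congr rfl
          intro q hq
          rw [mem_filter] at hq
          rw [if_neg (by simpa using hq.2.2), add_zero]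
      have hu : (-1) ^ (cnt (Sum.inl q0) + w q0) * lval (lt q0) = 1
          ∨ (-1) ^ (cnt (Sum.inl q0) + w q0) * lval (lt q0) = -1 := by
        rcases neg_one_pow_eq_or ℤ (cnt (Sum.inl q0) + w q0) with h1 | h1 <;>
        rcases lval_cases (lt q0) with h2 | h2 <;> rw [h1, h2] <;> simp
      rcases hu with hu | hu <;> rcases hE1 with hE1 | hE1
      · exact ⟨1, by omega, by rw [hfin, hu, hE1]; norm_num⟩
      · exact ⟨0, by omega, by rw [hfin, hu, hE1]; norm_num⟩
      · exact ⟨0, by omega, by rw [hfin, hu, hE1]; norm_num⟩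
      · exact ⟨1, by omega, by rw [hfin, hu, hE1]; norm_num⟩
    · refine ⟨0, by omega, ?_⟩
      have hi0 : i0 = i := by
        have := hpc i; rw [hpi] at this; exact Fin.ext this
      subst hi0
      rw [hpi] at h
      have hdd : (- d i0) ^ 2 = 1 := by rcases hd i0 with h | h <;> rw [h] <;> norm_num
      simp only [ne_eq, reduceCtorEq, not_false_eq_true, and_true, not_true_eq_false, if_false,
        m, Sum.elim_inr, hdd, add_zero] at h
      have hE2 : ∑ q ∈ univ.filter (fun q => (lt q).1 = i0),
        (-1) ^ (cnt (Sum.inl q) + w q) * (2 * lval (lt q)) =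
        2 * ∑ q ∈ univ.filter (fun q => (lt q).1 = i0),
        (-1) ^ (cnt (Sum.inl q) + w q) * lval (lt q) := by
        rw [mul_sum]; apply sum_congr rfl; intros; ring
      rw [hE2] at h
      simp only [ite_self, add_zero]
      nlinarith
  choose δ hδ1 hδ using hround
  let δs : Fin N → ℕ := fun q => if Sum.inl q = p (lt q).1 then δ (lt q).1 else 0
  have hδs : ∀ q, δs q = 0 ∨ (δs q ≤ 1 ∧ ∃ i, Sum.inl q = p i) := by
    intro q
    by_cases h : Sum.inl q = p (lt q).1
    · right
      refine ⟨?_, _, h⟩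
      simp only [δs]; rw [if_pos h]; exact hδ1 _
    · left; simp only [δs]; rw [if_neg h]
  have hstep : ∀ q y, key (Sum.inl q) < key y → cnt (Sum.inl q) + δs q ≤ cnt y := by
    intro q y h
    rcases hδs q with h0 | ⟨h1, i, hi⟩
    · rw [h0]; exact cuts_mono key n p _ _ h.le
    · have := cuts_add_one key n p i y (by rw [← hi]; exact h)
      rw [← hi] at this
      simp only [cnt]; omega
  have hcn : ∀ q, cnt (Sum.inl q) + δs q ≤ n := by
    intro q
    rcases hδs q with h0 | ⟨h1, i, hi⟩
    · rw [h0]; exact cuts_le key n p _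
    · have := cuts_lt key n p i
      rw [← hi] at this
      simp only [cnt]; omega
  let β : Fin N → ℕ := fun q => cnt (Sum.inl q) + w q + δs q
  have hβ : ∀ q, β q = cnt (Sum.inl q) + w q + δs q := fun _ => rfl
  have hβlt : ∀ q q', w q < w q' → β q < β q' := by
    intro q q' h
    have hlt : q < q' := by
      by_contra h'
      exact absurd (hw (not_lt.1 h')) (by omega)
    have := hstep q (Sum.inl q') ((K1 _ _).2 hlt)
    rw [hβ, hβ]; omega
  have hβn : ∀ q, β q < 2 * n := by
    intro q
    have := hcn q; have := hwn q
    rw [hβ]; omega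
  refine ⟨β, ?_, hβn, hβlt, ?_, ?_⟩
  · intro q q' h
    rcases h.eq_or_lt with rfl | h
    · exact le_rfl
    · have := hstep q (Sum.inl q') ((K1 _ _).2 h)
      have := hw h.le
      rw [hβ, hβ]; omega
  · intro i
    rw [← hδ i]
    apply sum_congr rfl
    intro q hq
    rw [mem_filter] at hq
    simp only [hβ, δs]
    rw [hq.2]
  · intro τ hτ
    -- every word lies in one block
    have hone : ∀ q, β q / 2 = w q := by
      intro q
      choose rep hrep using hsurj
      let f : Fin n → Fin n := fun i => if hi : (i : ℕ) = w q then ⟨β q / 2, by have := hβn q; omega⟩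
        else ⟨β (rep i i.2) / 2, by have := hβn (rep i i.2); omega⟩
      have hf0 : ∀ i : Fin n, ∃ q', w q' = i ∧ (f i : ℕ) = β q' / 2 := by
        intro i
        simp only [f]
        split_ifs with hi
        · exact ⟨q, hi.symm, rfl⟩
        · exact ⟨rep i i.2, hrep i i.2, rfl⟩
      have hf : StrictMono f := by
        intro i i' h
        obtain ⟨q1, h1, h2⟩ := hf0 i
        obtain ⟨q2, h3, h4⟩ := hf0 i'
        rw [Fin.lt_def, h2, h4]
        have := hβlt q1 q2 (by rw [h1, h3]; exact h)
        have := hτ q1; have := hτ q2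
        omega
      have := strict_id n f hf ⟨w q, hwn q⟩
      simp only [f, dif_pos] at this
      exact congrArg Fin.val this
    have hconst : ∀ q q', w q = w q' → β q = β q' := by
      intro q q' h
      have := hone q; have := hone q'
      have := hτ q; have := hτ q'
      omega
    have hnone : ∀ q q' i, w q = w q' → key (Sum.inl q) < key (p i) →
        key (p i) < key (Sum.inl q') → False := by
      intro q q' i h h1 h2
      have e1 := hstep q _ h1
      have e2 := cuts_add_one key n p i _ h2
      have e3 := hconst q q' h
      rw [hβ, hβ] at e3
      simp only [cnt] at e1 e3
      omega
    have hreg : ∀ i, ∃ q, p i = Sum.inl q := by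
      intro i
      rcases hpi : p i with q | i'
      · exact ⟨q, rfl⟩
      · exfalso
        apply hnone a a' i haw <;> rw [hpi]
        · exact K2 _
        · exact K3 _
    have hdum : ∀ i, cnt (Sum.inr i) + w a = β a := by
      intro i
      have e1 := hstep a _ (K2 i)
      have e2 := cuts_mono key n p _ _ (K3 i).le
      have e3 := hconst a a' haw
      rw [hβ, hβ] at e3
      rw [hβ]
      simp only [cnt] at *
      omega
    have hpow : ∀ x, x % 2 = τ → ((-1 : ℤ)) ^ x = (-1) ^ τ := by
      intro x hx
      rw [neg_one_pow_eq_pow_mod_two, hx]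
    have i : Fin n := ⟨w a, hwn a⟩
    obtain ⟨q0, hq0⟩ := hreg i
    have hti : (lt q0).1 = i := by
      have := hpc i; rw [hq0] at this; exact Fin.ext this
    have hval : lval (lt q0) = d i := by
      rw [← hti]
      apply hend
      intro q1 q2 h1 h2 h3 h4
      apply hnone q1 q2 i (h3.trans h4.symm) <;> rw [hq0]
      · exact (K1 _ _).2 h1
      · exact (K1 _ _).2 h2
    have h := hR i
    rw [hq0] at h
    simp only [ne_eq, Sum.inl.injEq, reduceCtorEq, not_false_eq_true, if_true, m, Sum.elim_inl]
        at h
    have hset : univ.filter (fun q => (lt q).1 = i)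
        = insert q0 (univ.filter (fun q => (lt q).1 = i ∧ ¬ q = q0)) := by
      ext q; simp only [mem_filter, mem_univ, true_and, mem_insert]
      constructor
      · tauto
      · rintro (rfl | h)
        · exact hti
        · exact h.1
    have hb := hbal i
    rw [hset, sum_insert (by simp)] at hb
    have hE2 : ∑ q ∈ univ.filter (fun q => (lt q).1 = i ∧ ¬ q = q0),
        (-1) ^ (cnt (Sum.inl q) + w q) * (2 * lval (lt q)) =
        (-1) ^ τ * (2 * ∑ q ∈ univ.filter (fun q => (lt q).1 = i ∧ ¬ q = q0), lval (lt q)) := by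
      rw [mul_sum, mul_sum]
      apply sum_congr rfl
      intro q hq
      rw [mem_filter] at hq
      have : cnt (Sum.inl q) + w q = β q := by
        rw [hβ]
        simp only [δs]
        rw [hq.2.1, hq0, if_neg (by simpa using hq.2.2), add_zero]
      rw [this, hpow _ (hτ q)]
    have hb' : ∑ q ∈ univ.filter (fun q => (lt q).1 = i ∧ ¬ q = q0), lval (lt q) = - d i := by
      linarith
    rw [hE2, hdum, hpow _ (hτ a), hb', hval, ← mul_add, mul_pow, ← pow_mul, mul_comm τ 2,
      pow_mul] at h
    rcases hd i with h' | h' <;> rw [h'] at h <;> norm_num at h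

end Split
section Blocks
open Finset

lemma filter_step {ι : Type} (f : ι → ℕ) (a c : ℕ) (hac : a ≤ c) (l : List ι)
    (hl : l.Pairwise (fun x y => f x ≤ f y)) :
    l.filter (fun x => decide (a ≤ f x ∧ f x < c)) ++ l.filter (fun x => decide (f x = c))
      = l.filter (fun x => decide (a ≤ f x ∧ f x < c + 1)) := by
  induction l with
  | nil => rfl
  | cons x l ih =>
    rw [List.pairwise_cons] at hl
    have ih := ih hl.2
    rcases lt_trichotomy (f x) c with h | h | h
    · by_cases h' : a ≤ f x
      · rw [List.filter_cons_of_pos (by simp; omega), List.filter_cons_of_neg (by simp; omega),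
          List.filter_cons_of_pos (by simp; omega), ← ih, List.cons_append]
      · rw [List.filter_cons_of_neg (by simp; omega), List.filter_cons_of_neg (by simp; omega),
          List.filter_cons_of_neg (by simp; omega), ih]
    · rw [List.filter_cons_of_neg (by simp; omega), List.filter_cons_of_pos (by simp; omega),
          List.filter_cons_of_pos (by simp; omega), ← ih]
      have : l.filter (fun x => decide (a ≤ f x ∧ f x < c)) = [] := by
        rw [List.filter_eq_nil_iff]
        intro y hy
        have := hl.1 y hy
        simp; omega
      rw [this]; simp
    · rw [List.filter_cons_of_neg (by simp; omega), List.filter_cons_of_neg (by simp; omega),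
          List.filter_cons_of_neg (by simp; omega), ih]

/-- the word formed by the tokens of class `ℓ` -/
def blk {A : Type} {N : ℕ} (lt : Fin N → A) (β : Fin N → ℕ) (ℓ : ℕ) : List A :=
  ((List.finRange N).filter (fun q => decide (β q = ℓ))).map lt

lemma blk_flatten {A : Type} {N : ℕ} (lt : Fin N → A) (β : Fin N → ℕ) (hβ : Monotone β)
    (a m : ℕ) : ((List.range' a m).map (blk lt β)).flatten
      = ((List.finRange N).filter (fun q => decide (a ≤ β q ∧ β q < a + m))).map lt := by
  induction m with
  | zero =>
    have : (List.finRange N).filter (fun q => decide (a ≤ β q ∧ β q < a + 0)) = [] := by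
      rw [List.filter_eq_nil_iff]
      intro y hy
      simp
    rw [this]; simp
  | succ m ih =>
    rw [List.range'_concat, List.map_append, List.flatten_append, ih, ← add_assoc,
      ← filter_step β a (a + m) (by omega)]
    · simp [blk]
    · refine List.Pairwise.imp ?_ (List.pairwise_lt_finRange N)
      intro x y h
      exact hβ h.le

/-- cut positions -/
def cutpos (n : ℕ) {N : ℕ} (w β : Fin N → ℕ) (j : ℕ) : ℕ :=
  if n ≤ j then 2 * n else (univ.filter (fun q => w q < j)).sup (fun q => β q + 1)

lemma bracket (n N : ℕ) (lt : Fin N → Fin n × Bool) (w β : Fin N → ℕ)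
    (hwn : ∀ q, w q < n) (hβ : Monotone β) (hβn : ∀ q, β q < 2 * n)
    (hwβ : ∀ q q', w q < w q' → β q < β q')
    (hx : Der n (fun t => blk lt β (2 * t))) (hy : Der n (fun t => blk lt β (2 * t + 1))) :
    Der n (fun j => blk lt w j) := by
  refine Der.binary _ _ _ (cutpos n w β) hx hy ?_ ?_ ?_ ?_
  · unfold cutpos
    split_ifs with h
    · omega
    · simp
  · simp [cutpos]
  · intro j hj
    unfold cutpos
    rw [if_neg (by omega)]
    split_ifs with h
    · apply Finset.sup_le
      intro q _
      exact hβn q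
    · apply Finset.sup_mono
      intro q
      simp only [mem_filter, mem_univ, true_and]
      omega
  · intro j
    have hinter : ∀ ℓ ∈ List.range' (cutpos n w β j) (cutpos n w β (j + 1) - cutpos n w β j),
        interleave n (fun t => blk lt β (2 * t)) (fun t => blk lt β (2 * t + 1)) ℓ
          = blk lt β ℓ := by
      intro ℓ hℓ
      have hle : cutpos n w β (j + 1) ≤ 2 * n := by
        unfold cutpos
        split_ifs
        · exact le_rfl
        · apply Finset.sup_le
          intro q _
          exact hβn q
      rw [List.mem_range'_1] at hℓ
      unfold interleave
      rw [dif_pos (by omega)]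
      split_ifs with h
      · change blk lt β (2 * (ℓ / 2)) = _
        rw [show 2 * (ℓ / 2) = ℓ by omega]
      · change blk lt β (2 * (ℓ / 2) + 1) = _
        rw [show 2 * (ℓ / 2) + 1 = ℓ by omega]
    rw [List.map_congr_left hinter, blk_flatten lt β hβ]
    unfold blk
    congr 1
    apply List.filter_congr
    intro q _
    rw [decide_eq_decide]
    have hj := j.2
    have e1 : w q = j → cutpos n w β j ≤ β q := by
      intro h
      unfold cutpos
      rw [if_neg (by omega)]
      apply Finset.sup_le
      intro q' hq'
      simp only [mem_filter, mem_univ, true_and] at hq'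
      exact hwβ q' q (by omega)
    have e2 : w q ≤ j → β q < cutpos n w β (j + 1) := by
      intro h
      unfold cutpos
      split_ifs
      · exact hβn q
      · apply Finset.le_sup (f := fun q => β q + 1)
        simp only [mem_filter, mem_univ, true_and]
        omega
    have e3 : w q < j → β q < cutpos n w β j := by
      intro h
      unfold cutpos
      rw [if_neg (by omega)]
      apply Finset.le_sup (f := fun q => β q + 1)
      simp only [mem_filter, mem_univ, true_and]
      omega
    have e4 : j < w q → cutpos n w β (j + 1) ≤ β q := by
      intro h
      have := hwn q
      unfold cutpos
      rw [if_neg (by omega)]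
      apply Finset.sup_le
      intro q' hq'
      simp only [mem_filter, mem_univ, true_and] at hq'
      exact hwβ q' q (by omega)
    rcases lt_trichotomy (w q) j with h | h | h
    · have := e3 h; omega
    · have := e1 h; have := e2 h.le; omega
    · have := e4 h; omega

lemma flatMap_single {A : Type} {n : ℕ} (s : Fin n → List A) (j : Fin n) (l : List (Fin n))
    (hl : l.Nodup) : l.flatMap (fun i => if i = j then s i else []) = if j ∈ l then s j else [] := by
  induction l with
  | nil => simp
  | cons x l ih =>
    rw [List.nodup_cons] at hl
    rw [List.flatMap_cons, ih hl.2]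
    by_cases h : x = j
    · subst h
      simp [hl.1]
    · have h' : ¬ j = x := fun e => h e.symm
      simp [h, h']

lemma represent {A : Type} (n : ℕ) (s : Fin n → List A) :
    ∃ (N : ℕ) (lt : Fin N → A) (w : Fin N → ℕ), Monotone w ∧ (∀ q, w q < n) ∧
      s = fun j : Fin n => blk lt w j := by
  let Z : List (Fin n × A) := (List.finRange n).flatMap (fun j => (s j).map (fun α => (j, α)))
  refine ⟨Z.length, fun q => (Z.get q).2, fun q => ((Z.get q).1 : ℕ), ?_, fun q => (Z.get q).1.2, ?_⟩
  · have hZ : Z.Pairwise (fun x y => x.1 ≤ y.1) := by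
      simp only [Z]
      rw [List.pairwise_flatMap]
      constructor
      · intro a _
        rw [List.pairwise_map]
        exact List.pairwise_of_forall (by simp)
      · refine List.Pairwise.imp ?_ (List.pairwise_lt_finRange n)
        intro a b hab x hx y hy
        simp only [List.mem_map] at hx hy
        obtain ⟨_, _, rfl⟩ := hx
        obtain ⟨_, _, rfl⟩ := hy
        exact hab.le
    intro q q' h
    rcases h.eq_or_lt with rfl | h
    · exact le_rfl
    · exact (List.pairwise_iff_get.1 hZ) q q' h
  · funext j
    have h1 : blk (fun q => (Z.get q).2) (fun q => ((Z.get q).1 : ℕ)) j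
        = (Z.filter (fun z => decide (z.1 = j))).map Prod.snd := by
      have hz : Z = (List.finRange Z.length).map Z.get := by simp
      conv_rhs => rw [hz]
      rw [List.filter_map, List.map_map]
      unfold blk
      simp only [Function.comp_def, Fin.ext_iff]
    rw [h1]
    simp only [Z]
    rw [List.filter_flatMap, List.map_flatMap]
    have := flatMap_single s j (List.finRange n) (List.nodup_finRange n)
    rw [if_pos (List.mem_finRange j)] at this
    rw [← this]
    congr 1
    funext i
    rw [List.filter_map, List.map_map]
    by_cases h : i = j
    · simp [h, Function.comp_def]
    · simp [h, Function.comp_def]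

lemma refine_exists (n N : ℕ) (hN : 0 < N) (w : Fin N → ℕ) (hw : Monotone w)
    (hwn : ∀ q, w q < n) : ∃ w' : Fin N → ℕ, Monotone w' ∧ (∀ q, w' q < n) ∧
      (∀ q q', w q < w q' → w' q < w' q') ∧
      ((∀ i < n, ∃ q, w' q = i) ∨ Function.Injective w') := by
  have hn : 0 < n := lt_of_le_of_lt (Nat.zero_le _) (hwn ⟨0, hN⟩)
  let V : ℕ → Finset ℕ := fun x => (univ.image w).filter (fun v => x < v)
  let D : Fin N → ℕ := fun q => (V (w q)).card
  have hDn : ∀ q, D q ≤ n - 1 := by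
    intro q
    have : V (w q) ⊆ Finset.Ioo (w q) n := by
      intro v
      simp only [V, mem_filter, mem_image, mem_univ, true_and, Finset.mem_Ioo]
      rintro ⟨⟨q', rfl⟩, h⟩
      exact ⟨h, hwn q'⟩
    have := card_le_card this
    rw [Nat.card_Ioo] at this
    simp only [D]; omega
  have hDmono : ∀ q q', q ≤ q' → D q' ≤ D q := by
    intro q q' h
    apply card_le_card
    intro v
    have := hw h
    simp only [V, mem_filter]
    rintro ⟨h1, h2⟩
    exact ⟨h1, by omega⟩
  have hDlt : ∀ q q', w q < w q' → D q' < D q := by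
    intro q q' h
    apply card_lt_card
    rw [Finset.ssubset_iff_of_subset]
    · exact ⟨w q', by simp [V, h], by simp [V]⟩
    · intro v
      simp only [V, mem_filter]
      rintro ⟨h1, h2⟩
      exact ⟨h1, by omega⟩
  have hDstep : ∀ q q' : Fin N, q'.val = q.val + 1 → D q ≤ D q' + 1 := by
    intro q q' h
    have : V (w q) ⊆ insert (w q') (V (w q')) := by
      intro v
      simp only [V, mem_filter, mem_image, mem_univ, true_and, mem_insert]
      rintro ⟨⟨r, rfl⟩, h1⟩
      have : q' ≤ r := by
        by_contra h2
        have : r ≤ q := by rw [Fin.le_def]; rw [not_le, Fin.lt_def] at h2; omega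
        have := hw this; omega
      have := hw this
      rcases this.eq_or_lt with h3 | h3
      · left; exact h3.symm
      · right; exact ⟨⟨r, rfl⟩, h3⟩
    exact (card_le_card this).trans (card_insert_le _ _)
  let w' : Fin N → ℕ := fun q => min q.val (n - 1 - D q)
  have hw' : ∀ q, w' q = min q.val (n - 1 - D q) := fun _ => rfl
  have hstep : ∀ q q' : Fin N, q'.val = q.val + 1 → w' q' ≤ w' q + 1 := by
    intro q q' h
    have := hDstep q q' h
    rw [hw', hw']; omega
  let last : Fin N := ⟨N - 1, by omega⟩
  have hDl : D last = 0 := by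
    simp only [D, V, card_eq_zero]
    rw [Finset.filter_eq_empty_iff]
    intro v hv
    simp only [mem_image, mem_univ, true_and] at hv
    obtain ⟨r, rfl⟩ := hv
    rw [not_lt]
    apply hw
    rw [Fin.le_def]
    simp only [last]; omega
  have hlast : w' last = min (N - 1) (n - 1) := by
    rw [hw', hDl]; simp [last]
  refine ⟨w', ?_, ?_, ?_, ?_⟩
  · intro q q' h
    have := hDmono q q' h
    rw [Fin.le_def] at h
    rw [hw', hw']; omega
  · intro q
    rw [hw']; omega
  · intro q q' h
    have hlt : q < q' := by
      by_contra h'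
      exact absurd (hw (not_lt.1 h')) (by omega)
    have := hDlt q q' h
    have := hDn q
    rw [Fin.lt_def] at hlt
    rw [hw', hw']; omega
  · rcases le_total n N with h | h
    · left
      intro i hi
      have hex : ∃ m, ∃ hm : m < N, i ≤ w' ⟨m, hm⟩ := ⟨N - 1, by omega, by
        have := hlast; simp only [last] at this; omega⟩
      classical
      obtain ⟨hm, hi1⟩ := Nat.find_spec hex
      refine ⟨⟨Nat.find hex, hm⟩, ?_⟩
      have hmin := fun m (h : m < Nat.find hex) => Nat.find_min hex h
      generalize Nat.find hex = m at hm hi1 hmin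
      rcases m with _ | m
      · have := hw' ⟨0, hm⟩
        simp only [Nat.zero_min] at this
        omega
      · have h1 := hmin m (by omega)
        push Not at h1
        have h1 := h1 (by omega)
        have := hstep ⟨m, by omega⟩ ⟨m + 1, hm⟩ rfl
        omega
    · right
      have key : ∀ k, ∀ hk : k < N, N - 1 ≤ w' ⟨N - 1 - k, by omega⟩ + k := by
        intro k
        induction k with
        | zero =>
          intro _
          have := hlast; simp only [last] at this
          simp only [Nat.sub_zero]; omega
        | succ k ih =>
          intro hk
          have h1 := ih (by omega)
          have h2 := hstep ⟨N - 1 - (k + 1), by omega⟩ ⟨N - 1 - k, by omega⟩ (by simp only; omega)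
          omega
      have hid : ∀ q, w' q = q := by
        intro q
        have h1 := key (N - 1 - q) (by omega)
        have h2 : (⟨N - 1 - (N - 1 - q), by omega⟩ : Fin N) = q := by
          apply Fin.ext; simp only; omega
        rw [h2] at h1
        have h3 := hw' q
        have := q.2
        omega
      intro q q' hqq
      rw [hid, hid] at hqq
      exact Fin.ext hqq

end Blocks
section Weights
open Finset

/-- total weight of a tuple -/
def wt {n : ℕ} (φ : Fin n × Bool → ℤ) (s : Fin n → List (Fin n × Bool)) : ℤ :=
  ∑ j, ((s j).map φ).sum

/-- signed indicator of the letters of type `i` -/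
def chi {n : ℕ} (i : Fin n) (α : Fin n × Bool) : ℤ := if α.1 = i then lval α else 0

lemma chi_bar {n : ℕ} (i : Fin n) (α : Fin n × Bool) : chi i α + chi i (α.1, !α.2) = 0 := by
  unfold chi lval
  rcases α with ⟨a, b⟩
  cases b <;> by_cases h : a = i <;> simp [h]

lemma chi_sum {n : ℕ} (i : Fin n) (l : List (Fin n × Bool)) :
    (l.map (chi i)).sum = (l.count (i, true) : ℤ) - l.count (i, false) := by
  induction l with
  | nil => simp
  | cons α l ih =>
    rw [List.map_cons, List.sum_cons, ih, List.count_cons, List.count_cons]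
    unfold chi lval
    rcases α with ⟨a, b⟩
    cases b <;> by_cases h : a = i <;> simp [h] <;> ring

lemma wt_flatten {n : ℕ} (φ : Fin n × Bool → ℤ) (s : Fin n → List (Fin n × Bool)) :
    ((List.ofFn s).flatten.map φ).sum = wt φ s := by
  rw [List.map_flatten, List.sum_flatten, List.map_map, List.map_ofFn, List.sum_ofFn]
  rfl

lemma bal_iff {n : ℕ} (s : Fin n → List (Fin n × Bool)) (i : Fin n) :
    (List.ofFn s).flatten.count (i, true) = (List.ofFn s).flatten.count (i, false)
      ↔ wt (chi i) s = 0 := by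
  rw [← wt_flatten, chi_sum]
  omega

lemma blk_sum {n N : ℕ} (φ : Fin n × Bool → ℤ) (lt : Fin N → Fin n × Bool) (β : Fin N → ℕ) (ℓ : ℕ) :
    ((blk lt β ℓ).map φ).sum = ∑ q, if β q = ℓ then φ (lt q) else 0 := by
  unfold blk
  rw [Fin.sum_univ_def]
  generalize List.finRange N = l
  induction l with
  | nil => simp
  | cons x l ih =>
    by_cases h : β x = ℓ
    · simp [h]; simpa using ih
    · simp [h]; simpa using ih

lemma wt_blk {n N : ℕ} (φ : Fin n × Bool → ℤ) (lt : Fin N → Fin n × Bool) (w : Fin N → ℕ)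
    (hw : ∀ q, w q < n) : wt φ (fun j => blk lt w j) = ∑ q, φ (lt q) := by
  unfold wt
  simp only [blk_sum]
  rw [sum_comm]
  apply sum_congr rfl
  intro q _
  rw [Finset.sum_eq_single ⟨w q, hw q⟩]
  · simp
  · intro b _ hb
    rw [if_neg]
    intro h
    exact hb (Fin.ext h.symm)
  · simp

lemma wt_blk2 {n N : ℕ} (φ : Fin n × Bool → ℤ) (lt : Fin N → Fin n × Bool) (β : Fin N → ℕ)
    (hβ : ∀ q, β q < 2 * n) (τ : ℕ) (hτ : τ < 2) :
    wt φ (fun j => blk lt β (2 * j + τ)) = ∑ q, if β q % 2 = τ then φ (lt q) else 0 := by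
  unfold wt
  simp only [blk_sum]
  rw [sum_comm]
  apply sum_congr rfl
  intro q _
  have := hβ q
  rw [Finset.sum_eq_single ⟨β q / 2, by omega⟩]
  · congr 1
    simp only [eq_iff_iff]
    omega
  · intro b _ hb
    rw [if_neg]
    intro h
    apply hb
    apply Fin.ext
    simp only
    omega
  · simp

lemma wt_pair {n : ℕ} (φ : Fin n × Bool → ℤ) (x w : Fin n → List (Fin n × Bool))
    (α γ : Fin n × Bool) (a b : Fin n)
    (u v : Bool) (hab : a ≠ b)
    (ha : w a = if u then α :: x a else x a ++ [α])
    (hb : w b = if v then γ :: x b else x b ++ [γ])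
    (hother : ∀ j, j ≠ a → j ≠ b → w j = x j) : wt φ w = wt φ x + φ α + φ γ := by
  have h : ∀ j, ((w j).map φ).sum = ((x j).map φ).sum + (if j = a then φ α else 0)
      + (if j = b then φ γ else 0) := by
    intro j
    by_cases h1 : j = a
    · subst h1
      rw [ha]
      cases u <;> simp [hab]; ring
    · by_cases h2 : j = b
      · subst h2
        rw [hb]
        cases v <;> simp [h1]; ring
      · rw [hother j h1 h2]; simp [h1, h2]
  unfold wt
  simp only [h, sum_add_distrib]
  simp

lemma wt_wrap {n : ℕ} (φ : Fin n × Bool → ℤ) (x w : Fin n → List (Fin n × Bool))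
    (α γ : Fin n × Bool) (a : Fin n)
    (ha : w a = α :: (x a ++ [γ]))
    (hother : ∀ j, j ≠ a → w j = x j) : wt φ w = wt φ x + φ α + φ γ := by
  have h : ∀ j, ((w j).map φ).sum = ((x j).map φ).sum + (if j = a then φ α + φ γ else 0) := by
    intro j
    by_cases h1 : j = a
    · subst h1
      rw [ha]
      simp; ring
    · rw [hother j h1]; simp [h1]
  unfold wt
  simp only [h, sum_add_distrib]
  simp [add_assoc]

lemma sum_even_odd (g : ℕ → ℤ) (m : ℕ) :
    ∑ ℓ ∈ range (2 * m), g ℓ = ∑ t ∈ range m, (g (2 * t) + g (2 * t + 1)) := by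
  induction m with
  | zero => simp
  | succ m ih =>
    rw [show 2 * (m + 1) = 2 * m + 1 + 1 by ring, sum_range_succ, sum_range_succ, ih,
      sum_range_succ]
    ring

lemma sum_range'_eq (g : ℕ → ℤ) (a m : ℕ) :
    ((List.range' a m).map g).sum = ∑ ℓ ∈ range (a + m), g ℓ - ∑ ℓ ∈ range a, g ℓ := by
  induction m with
  | zero => simp
  | succ m ih =>
    rw [List.range'_concat, List.map_append, List.sum_append, ih, ← add_assoc, sum_range_succ]
    simp
    ring

lemma wt_binary {n : ℕ} (φ : Fin n × Bool → ℤ) (x y w : Fin n → List (Fin n × Bool)) (k : ℕ → ℕ)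
      (h0 : k 0 = 0) (hend : k n = 2 * n) (hmono : ∀ j, j < n → k j ≤ k (j + 1))
      (hw : ∀ j : Fin n, w j =
        ((List.range' (k j) (k ((j : ℕ) + 1) - k j)).map (interleave n x y)).flatten) :
    wt φ w = wt φ x + wt φ y := by
  let g : ℕ → ℤ := fun ℓ => ((interleave n x y ℓ).map φ).sum
  have h1 : ∀ j : Fin n, ((w j).map φ).sum
      = ∑ ℓ ∈ range (k (j + 1)), g ℓ - ∑ ℓ ∈ range (k j), g ℓ := by
    intro j
    rw [hw j, List.map_flatten, List.sum_flatten, List.map_map, List.map_map]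
    have := sum_range'_eq g (k j) (k (j + 1) - k j)
    rw [Nat.add_sub_cancel' (hmono j j.2)] at this
    rw [← this]
    rfl
  unfold wt
  simp only [h1]
  rw [Fin.sum_univ_eq_sum_range (fun j => ∑ ℓ ∈ range (k (j + 1)), g ℓ - ∑ ℓ ∈ range (k j), g ℓ),
    Finset.sum_range_sub (fun j => ∑ ℓ ∈ range (k j), g ℓ), h0, hend, sum_even_odd,
    ← sum_add_distrib, ← Fin.sum_univ_eq_sum_range (fun t => g (2 * t) + g (2 * t + 1))]
  simp only [range_zero, sum_empty, sub_zero]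
  apply sum_congr rfl
  intro t _
  have ht := t.2
  have e1 : interleave n x y (2 * t) = x t := by
    unfold interleave
    rw [dif_pos (by omega), if_pos (by omega)]
    congr 1
    apply Fin.ext
    simp
  have e2 : interleave n x y (2 * t + 1) = y t := by
    unfold interleave
    rw [dif_pos (by omega), if_neg (by omega)]
    congr 1
    apply Fin.ext
    simp only
    omega
  simp only [g, e1, e2]

lemma sound {n : ℕ} (s : Fin n → List (Fin n × Bool)) (h : Der n s) (i : Fin n) :
    wt (chi i) s = 0 := by
  induction h with
  | empty => simp [wt]
  | binary x y w k hx hy h0 hend hmono hw ihx ihy =>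
    rw [wt_binary _ x y w k h0 hend hmono hw, ihx, ihy, add_zero]
  | pair x w α a b u v hab hx ha hb hother ih =>
    rw [wt_pair _ x w α _ a b u v hab ha hb hother, ih, add_assoc, chi_bar, add_zero]
  | wrap x w α a hx ha hother ih =>
    rw [wt_wrap _ x w α _ a ha hother, ih, add_assoc, chi_bar, add_zero]

end Weights
section Main
open Finset

/-- `α` is the first or last letter of the `j`-th word -/
def IsEnd {n : ℕ} (t : Fin n → List (Fin n × Bool)) (j : Fin n) (α : Fin n × Bool) : Prop :=
  ∃ (u : Bool) (r : List (Fin n × Bool)), t j = if u then α :: r else r ++ [α]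

lemma sorted_first {N : ℕ} (L : List (Fin N)) (hL : L.Pairwise (· < ·)) (q : Fin N) (hq : q ∈ L)
    (h : ∀ q' ∈ L, ¬ q' < q) : ∃ r, L = q :: r := by
  rcases L with _ | ⟨x, r⟩
  · simp at hq
  · rw [List.pairwise_cons] at hL
    rcases List.mem_cons.1 hq with rfl | h1
    · exact ⟨r, rfl⟩
    · exact absurd (hL.1 q h1) (h x (by simp))

lemma sorted_last {N : ℕ} (L : List (Fin N)) (hL : L.Pairwise (· < ·)) (q : Fin N) (hq : q ∈ L)
    (h : ∀ q' ∈ L, ¬ q < q') : ∃ r, L = r ++ [q] := by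
  rcases List.eq_nil_or_concat L with rfl | ⟨r, x, rfl⟩
  · simp at hq
  · rw [List.concat_eq_append] at *
    rw [List.pairwise_append] at hL
    rcases List.mem_append.1 hq with h1 | h1
    · exact absurd (hL.2.2 q h1 x (by simp)) (h x (by simp))
    · rw [List.mem_singleton] at h1
      subst h1
      exact ⟨r, rfl⟩

lemma isEnd_token {n N : ℕ} (lt : Fin N → Fin n × Bool) (w : Fin N → ℕ) (hwn : ∀ q, w q < n)
    (q : Fin N) (hq : ∀ q1 q2, q1 < q → q < q2 → w q1 = w q → w q2 = w q → False) :
    IsEnd (fun j : Fin n => blk lt w j) ⟨w q, hwn q⟩ (lt q) := by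
  have hs : ((List.finRange N).filter (fun x => decide (w x = w q))).Pairwise (· < ·) :=
    (List.pairwise_lt_finRange N).filter _
  have hm : q ∈ (List.finRange N).filter (fun x => decide (w x = w q)) := by simp
  by_cases h : ∃ q1, q1 < q ∧ w q1 = w q
  · obtain ⟨q1, h1, h2⟩ := h
    obtain ⟨r, hr⟩ := sorted_last _ hs q hm (by
      intro q' hq' hlt
      simp at hq'
      exact hq q1 q' h1 hlt h2 hq')
    refine ⟨false, r.map lt, ?_⟩
    simp [blk, hr]
  · obtain ⟨r, hr⟩ := sorted_first _ hs q hm (by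
      intro q' hq' hlt
      simp at hq'
      exact h ⟨q', hlt, hq'⟩)
    refine ⟨true, r.map lt, ?_⟩
    simp [blk, hr]

lemma wrap_case {n : ℕ} (t : Fin n → List (Fin n × Bool)) (a : Fin n) (α γ : Fin n × Bool)
    (hγ : γ = (α.1, !α.2)) (r r' : List (Fin n × Bool)) (h1 : t a = α :: r) (h2 : t a = r' ++ [γ])
    (IH : ∀ x, wt (fun _ => 1) x < wt (fun _ => 1) t → (∀ i, wt (chi i) x = wt (chi i) t) → Der n x) :
    Der n t := by
  have hne : α ≠ γ := by
    rw [hγ]; intro h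
    have := congrArg Prod.snd h
    simp at this
  rcases r' with _ | ⟨z, r''⟩
  · rw [h1] at h2
    simp at h2
    exact absurd h2.1 hne
  · have hz : z = α := by
      rw [h1] at h2; simp at h2; exact h2.1.symm
    subst hz
    have ha : t a = z :: ((Function.update t a r'') a ++ [γ]) := by simp [h2]
    have ho : ∀ j, j ≠ a → t j = Function.update t a r'' j := by
      intro j hj; simp [hj]
    have hwt := fun φ => wt_wrap φ _ t z γ a ha ho
    refine Der.wrap (Function.update t a r'') t z a ?_ (by rw [← hγ]; exact ha) ho
    apply IH
    · rw [hwt]; omega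
    · intro i
      rw [hwt, add_assoc, hγ, chi_bar, add_zero]

lemma pair_case {n : ℕ} (t : Fin n → List (Fin n × Bool)) (a b : Fin n) (α : Fin n × Bool)
    (h1 : IsEnd t a α) (h2 : IsEnd t b (α.1, !α.2))
    (IH : ∀ x, wt (fun _ => 1) x < wt (fun _ => 1) t → (∀ i, wt (chi i) x = wt (chi i) t) → Der n x) :
    Der n t := by
  obtain ⟨u, r, hu⟩ := h1
  obtain ⟨v, r', hv⟩ := h2
  by_cases hab : a = b
  · subst hab
    have hne : α ≠ (α.1, !α.2) := by
      intro h
      have := congrArg Prod.snd h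
      simp at this
    rw [hu] at hv
    cases u <;> cases v
    · simp at hv; exact absurd hv.2 hne
    · simp at hv hu
      exact wrap_case t a (α.1, !α.2) α (by simp) r' r (by rw [hu, hv]) hu IH
    · simp at hv hu
      exact wrap_case t a α (α.1, !α.2) rfl r r' hu (by rw [hu, hv]) IH
    · simp at hv; exact absurd hv.1 hne
  · have hba : b ≠ a := fun h => hab h.symm
    let x := Function.update (Function.update t a r) b r'
    have hxa : x a = r := by simp [x, hab]
    have hxb : x b = r' := by simp [x]
    have ha : t a = if u then α :: x a else x a ++ [α] := by rw [hxa]; exact hu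
    have hb : t b = if v then (α.1, !α.2) :: x b else x b ++ [(α.1, !α.2)] := by rw [hxb]; exact hv
    have ho : ∀ j, j ≠ a → j ≠ b → t j = x j := by
      intro j h1 h2; simp [x, h1, h2]
    have hwt := fun φ => wt_pair φ x t α _ a b u v hab ha hb ho
    refine Der.pair x t α a b u v hab ?_ ha hb ho
    apply IH
    · rw [hwt]; omega
    · intro i
      rw [hwt, add_assoc, chi_bar, add_zero]

lemma exists_bar {n N : ℕ} (lt : Fin N → Fin n × Bool)
    (hb : ∀ i, ∑ q, chi i (lt q) = 0) (q0 : Fin N) : ∃ q, lt q = ((lt q0).1, !(lt q0).2) := by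
  by_contra h
  push Not at h
  have h1 := hb (lt q0).1
  have h2 : 0 < ∑ q, lval (lt q0) * chi (lt q0).1 (lt q) := by
    apply Finset.sum_pos'
    · intro q _
      have := h q
      unfold chi lval
      rcases hq : lt q with ⟨a, b⟩
      rcases hq0 : lt q0 with ⟨a0, b0⟩
      rw [hq, hq0] at this
      by_cases e : a = a0
      · subst e
        cases b <;> cases b0 <;> simp at this ⊢
      · simp [e]
    · refine ⟨q0, mem_univ _, ?_⟩
      unfold chi
      rcases lval_cases (lt q0) with h | h <;> simp [h]
  rw [← mul_sum, h1] at h2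
  simp at h2

theorem complete (n k : ℕ) : ∀ s : Fin n → List (Fin n × Bool), wt (fun _ => 1) s < k →
    (∀ i, wt (chi i) s = 0) → Der n s := by
  induction k with
  | zero =>
    intro s hs
    exfalso
    have : 0 ≤ wt (fun _ => 1) s := by
      unfold wt
      apply sum_nonneg
      intro j _
      simp
    simp at hs
    omega
  | succ k ih =>
    intro s hs hbal
    obtain ⟨N, lt, w0, hw0, hw0n, rfl⟩ := represent n s
    rcases Nat.eq_zero_or_pos N with rfl | hN
    · have : (fun j : Fin n => blk lt w0 j) = fun _ => [] := by
        funext j; simp [blk]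
      rw [this]; exact Der.empty
    obtain ⟨w, hw, hwn, hww, hcase⟩ := refine_exists n N hN w0 hw0 hw0n
    rw [wt_blk _ lt w0 hw0n] at hs
    simp only [wt_blk _ lt w0 hw0n] at hbal
    suffices hD : Der n (fun j => blk lt w j) by
      refine bracket n N lt w0 (fun q => 2 * w q) hw0n ?_ ?_ ?_ ?_ ?_
      · intro q q' h
        have := hw h
        simp only; omega
      · intro q; have := hwn q; omega
      · intro q q' h; have := hww q q' h; omega
      · have : (fun t : Fin n => blk lt (fun q => 2 * w q) (2 * t)) = fun j : Fin n => blk lt w j := by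
          funext t
          unfold blk
          congr 1
          apply List.filter_congr
          intro q _
          rw [decide_eq_decide]
          change 2 * w q = 2 * (t : ℕ) ↔ w q = (t : ℕ)
          omega
        rw [this]; exact hD
      · have : (fun t : Fin n => blk lt (fun q => 2 * w q) (2 * t + 1)) = fun _ => [] := by
          funext t
          unfold blk
          rw [List.map_eq_nil_iff, List.filter_eq_nil_iff]
          intro q _
          simp only [decide_eq_true_eq]; omega
        rw [this]; exact Der.empty
    by_cases hA : ∃ (a b : Fin n) (α : Fin n × Bool), IsEnd (fun j : Fin n => blk lt w j) a α ∧
        IsEnd (fun j : Fin n => blk lt w j) b (α.1, !α.2)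
    · obtain ⟨a, b, α, h1, h2⟩ := hA
      apply pair_case _ a b α h1 h2
      intro x hx hxb
      rw [wt_blk _ lt w hwn] at hx
      apply ih
      · push_cast at hs; omega
      · intro i
        rw [hxb, wt_blk _ lt w hwn, hbal]
    · have hinj : ¬ Function.Injective w := by
        intro hinj
        obtain ⟨q, hq⟩ := exists_bar lt hbal ⟨0, hN⟩
        apply hA
        refine ⟨_, ⟨w q, hwn q⟩, lt ⟨0, hN⟩, isEnd_token lt w hwn _ ?_, ?_⟩
        · intro q1 q2 h1 _ h3 _
          exact absurd (hinj h3) h1.ne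
        · rw [← hq]
          apply isEnd_token lt w hwn
          intro q1 q2 h1 _ h3 _
          exact absurd (hinj h3) h1.ne
      have hsurj := hcase.resolve_right hinj
      have hadj : ∃ a a' : Fin N, a'.val = a.val + 1 ∧ w a = w a' := by
        have : ∃ q q' : Fin N, q < q' ∧ w q = w q' := by
          unfold Function.Injective at hinj
          push Not at hinj
          obtain ⟨q, q', h1, h2⟩ := hinj
          rcases lt_or_gt_of_ne h2 with h | h
          · exact ⟨q, q', h, h1⟩
          · exact ⟨q', q, h, h1.symm⟩
        obtain ⟨q, q', h1, h2⟩ := this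
        rw [Fin.lt_def] at h1
        refine ⟨q, ⟨q + 1, by omega⟩, rfl, ?_⟩
        apply le_antisymm
        · apply hw; rw [Fin.le_def]; simp
        · rw [h2]; apply hw; rw [Fin.le_def]; simp only; omega
      obtain ⟨a, a', ha, haw⟩ := hadj
      classical
      let d : Fin n → ℤ := fun i =>
        if ∃ j, IsEnd (fun j : Fin n => blk lt w j) j (i, true) then 1 else -1
      have hchi : ∀ (i : Fin n) (f : Fin N → ℤ),
          ∑ q ∈ univ.filter (fun q => (lt q).1 = i), f q * lval (lt q) = ∑ q, f q * chi i (lt q) := by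
        intro i f
        rw [sum_filter]
        apply sum_congr rfl
        intro q _
        unfold chi
        split_ifs <;> simp
      have hsplit := split_exists n N lt w hw hwn hsurj (by
          intro i
          have := hchi i (fun _ => 1)
          simp only [one_mul, hbal] at this
          convert this) a a' ha haw d (by
          intro i
          simp only [d]
          split_ifs <;> simp) (by
          intro q hq
          have he := isEnd_token lt w hwn q hq
          simp only [d]
          split_ifs with h
          · obtain ⟨j, hj⟩ := h
            by_contra hl
            apply hA
            refine ⟨_, ⟨w q, hwn q⟩, _, hj, ?_⟩
            convert he using 1
            rcases hlt : lt q with ⟨c, e⟩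
            rw [hlt] at hl
            cases e <;> simp [lval] at hl ⊢
          · rcases hlt : lt q with ⟨c, e⟩
            rw [hlt] at h he
            cases e
            · simp [lval]
            · exact absurd ⟨_, he⟩ h)
      obtain ⟨β, hβ, hβn, hwβ, hβs, hβτ⟩ := hsplit
      have hβs' : ∀ i, ∑ q, (-1) ^ β q * chi i (lt q) = 0 := by
        intro i
        rw [← hchi i (fun q => (-1) ^ β q)]
        convert hβs i
      have hpar : ∀ i, (∑ q, if β q % 2 = 0 then chi i (lt q) else 0) = 0 ∧
          (∑ q, if β q % 2 = 1 then chi i (lt q) else 0) = 0 := by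
        intro i
        have e1 : (∑ q, if β q % 2 = 0 then chi i (lt q) else 0)
            + (∑ q, if β q % 2 = 1 then chi i (lt q) else 0) = 0 := by
          rw [← sum_add_distrib]
          refine Eq.trans ?_ (hbal i)
          apply sum_congr rfl
          intro q _
          rcases Nat.mod_two_eq_zero_or_one (β q) with h | h <;> simp [h]
        have e2 : (∑ q, if β q % 2 = 0 then chi i (lt q) else 0)
            - (∑ q, if β q % 2 = 1 then chi i (lt q) else 0) = 0 := by
          rw [← sum_sub_distrib]
          refine Eq.trans ?_ (hβs' i)
          apply sum_congr rfl
          intro q _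
          rw [neg_one_pow_eq_pow_mod_two]
          rcases Nat.mod_two_eq_zero_or_one (β q) with h | h <;> simp [h]
        constructor <;> linarith
      have hlen : ∀ τ, (∑ q, if β q % 2 = τ then (1 : ℤ) else 0) < ∑ q : Fin N, 1 := by
        intro τ
        have := hβτ τ
        push Not at this
        obtain ⟨q, hq⟩ := this
        apply sum_lt_sum
        · intro q _; split_ifs <;> simp
        · exact ⟨q, mem_univ _, by simp [hq]⟩
      apply bracket n N lt w β hwn hβ hβn hwβ
      · apply ih
        · have := wt_blk2 (fun _ => 1) lt β hβn 0 (by omega)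
          simp only [add_zero] at this
          rw [this]
          have := hlen 0
          push_cast at hs
          omega
        · intro i
          have := wt_blk2 (chi i) lt β hβn 0 (by omega)
          simp only [add_zero] at this
          rw [this, (hpar i).1]
      · apply ih
        · rw [wt_blk2 (fun _ => 1) lt β hβn 1 (by omega)]
          have := hlen 1
          push_cast at hs
          omega
        · intro i
          rw [wt_blk2 (chi i) lt β hβn 1 (by omega), (hpar i).2]

lemma complete_tuple (n : ℕ) (s : Fin n → List (Fin n × Bool))
    (h : ∀ i : Fin n, ((List.ofFn s).flatten).count (i, true) =
        ((List.ofFn s).flatten).count (i, false)) : Der n s := by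
  apply complete n ((wt (fun _ => 1) s).toNat + 1) s
  · have := Int.self_le_toNat (wt (fun _ => 1) s)
    push_cast; omega
  · intro i
    exact (bal_iff s i).1 (h i)

end Main

/-- completeness of `G_n`: for every tuple `(s_1, …, s_n)` with
`s_1 ⋯ s_n ∈ O_n` the judgment `⊢_{G_n} I(s_1, …, s_n)` is derivable;
consequently the language of `G_n` is exactly `O_n`. -/
theorem stmt19 (n : ℕ) :
    (∀ s : Fin n → List (Fin n × Bool),
      (∀ i : Fin n, ((List.ofFn s).flatten).count (i, true) =
        ((List.ofFn s).flatten).count (i, false)) →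
      Der n s) ∧
    (∀ w : List (Fin n × Bool), SDer n w ↔
      ∀ i : Fin n, w.count (i, true) = w.count (i, false)) := by
  refine ⟨complete_tuple n, ?_⟩
  intro w
  constructor
  · rintro ⟨s, hs, rfl⟩ i
    exact (bal_iff s i).2 (sound s hs i)
  · intro h
    rcases n with _ | n
    · refine ⟨fun _ => [], Der.empty, ?_⟩
      rcases w with _ | ⟨α, w⟩
      · simp
      · exact α.1.elim0
    · have hw : (List.ofFn (Fin.cons w (fun _ => []) : Fin (n + 1) → List (Fin (n + 1) × Bool))).flatten
          = w := by
        rw [List.ofFn_succ]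
        simp
      refine ⟨Fin.cons w (fun _ => []), complete_tuple _ _ ?_, hw.symm⟩
      rw [hw]
      exact h
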